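/- arXiv:2107.12416 — 4 statements merged into one kernel-verified Lean document; each statement's English description precedes it below -/
import Mathlib

section
/- Let d ≥ 1 and r > 0, and let f : ℝ^d → ℝ be Lipschitz continuous. Define the smoothed function f̂(x) = E_{v∼Uni(𝔹_d)}[f(x + r v)]. Then f̂ is differentiable at every x ∈ ℝ^d and its gradient satisfies ∇f̂(x) = (d/r) · E_{u∼Uni(𝕊_{d−1})}[f(x + r u) u]. -/
open MeasureTheory Metric

/-- The uniform probability distribution on the closed Euclidean unit ball in `ℝ^d`
(normalized Lebesgue measure). -/
noncomputable def unifBall (d : ℕ) : Measure (EuclideanSpace ℝ (Fin d)) :=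
  (volume (closedBall (0 : EuclideanSpace ℝ (Fin d)) 1))⁻¹ •
    volume.restrict (closedBall (0 : EuclideanSpace ℝ (Fin d)) 1)

/-- The uniform probability distribution on the Euclidean unit sphere in `ℝ^d`
(normalized surface measure). -/
noncomputable def unifSphere (d : ℕ) : Measure (sphere (0 : EuclideanSpace ℝ (Fin d)) 1) :=
  ((volume : Measure (EuclideanSpace ℝ (Fin d))).toSphere Set.univ)⁻¹ •
    (volume : Measure (EuclideanSpace ℝ (Fin d))).toSphere

section aux
set_option linter.unusedSectionVars false
variable {E : Type*} [NormedAddCommGroup E] [InnerProductSpace ℝ E] [FiniteDimensional ℝ E]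
  [MeasurableSpace E] [BorelSpace E] [Nontrivial E] (μ : Measure E) [μ.IsAddHaarMeasure]

lemma aux_polar (F : E → ℝ) (hF : Integrable F μ) :
    ∫ v, F v ∂μ = ∫ s in Set.Ioi (0 : ℝ), s ^ (Module.finrank ℝ E - 1) *
      ∫ u : sphere (0 : E) 1, F (s • (u : E)) ∂μ.toSphere := by
  set n := Module.finrank ℝ E - 1
  have hmp := μ.measurePreserving_homeomorphUnitSphereProd
  have hemb := (homeomorphUnitSphereProd E).measurableEmbedding
  have hFc : ∀ x : ({(0)}ᶜ : Set E),
      (fun p : sphere (0 : E) 1 × Set.Ioi (0 : ℝ) => F ((p.2 : ℝ) • (p.1 : E)))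
        (homeomorphUnitSphereProd E x) = F x := by
    intro x
    have hx : ‖(x : E)‖ ≠ 0 := norm_ne_zero_iff.2 x.2
    simp [smul_smul, hx]
  have hint : Integrable (fun p : sphere (0 : E) 1 × Set.Ioi (0 : ℝ) => F ((p.2 : ℝ) • (p.1 : E)))
      (μ.toSphere.prod (.volumeIoiPow n)) := by
    rw [← hmp.integrable_comp_emb hemb]
    have : Integrable (fun x : ({(0)}ᶜ : Set E) => F x) (μ.comap (↑)) := by
      have := (integrableOn_iff_comap_subtypeVal (μ := μ) (f := F)
        (measurableSet_singleton (0 : E)).compl).1 hF.integrableOn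
      exact this
    exact this.congr (.of_forall fun x => (hFc x).symm)
  calc
    ∫ v, F v ∂μ = ∫ x : ({(0)}ᶜ : Set E), F x ∂(μ.comap (↑)) := by
      rw [integral_subtype_comap (measurableSet_singleton _).compl fun x ↦ F x,
        restrict_compl_singleton]
    _ = ∫ p, F ((p.2 : ℝ) • (p.1 : E)) ∂μ.toSphere.prod (.volumeIoiPow n) := by
      rw [← hmp.integral_comp hemb]
      exact integral_congr_ae (.of_forall fun x => (hFc x).symm)
    _ = ∫ s : Set.Ioi (0 : ℝ), ∫ u : sphere (0 : E) 1, F ((s : ℝ) • (u : E)) ∂μ.toSphere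
          ∂(Measure.volumeIoiPow n) := integral_prod_symm _ hint
    _ = _ := by
      simp only [Measure.volumeIoiPow, ENNReal.ofReal]
      rw [integral_withDensity_eq_integral_smul,
        integral_subtype_comap measurableSet_Ioi fun a : ℝ ↦ Real.toNNReal (a ^ n) •
          ∫ u : sphere (0 : E) 1, F (a • (u : E)) ∂μ.toSphere,
        setIntegral_congr_fun measurableSet_Ioi fun x hx ↦ ?_]
      · rw [NNReal.smul_def, Real.coe_toNNReal _ (pow_nonneg (le_of_lt hx) _), smul_eq_mul]
      · exact (measurable_subtype_coe.pow_const _).real_toNNReal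

/-- the cone cutoff -/
lemma aux_lip (s : ℝ) : LipschitzWith 1 (fun v : E => max 0 (s - ‖v‖)) := by
  apply LipschitzWith.const_max
  refine LipschitzWith.of_dist_le_mul fun a b => ?_
  simp only [NNReal.coe_one, one_mul, dist_eq_norm]
  rw [show s - ‖a‖ - (s - ‖b‖) = ‖b‖ - ‖a‖ by ring, norm_sub_rev a b]
  exact abs_norm_sub_norm_le b a

lemma aux_supp (s : ℝ) : HasCompactSupport (fun v : E => max 0 (s - ‖v‖)) := by
  refine HasCompactSupport.intro (isCompact_closedBall (0 : E) s) fun v hv => ?_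
  simp only [mem_closedBall, dist_zero_right, not_le] at hv
  exact max_eq_left (by linarith)

lemma aux_lineDeriv (s : ℝ) (e v : E) (hv0 : v ≠ 0) (hvs : ‖v‖ ≠ s) :
    lineDeriv ℝ (fun v : E => max 0 (s - ‖v‖)) v (-e) =
      (ball (0 : E) s).indicator (fun v => inner ℝ (‖v‖⁻¹ • v) e) v := by
  rcases lt_or_gt_of_ne hvs with h | h
  · have hn : HasFDerivAt (fun v : E => ‖v‖) (‖v‖⁻¹ • innerSL ℝ v) v := by
      have h1 := (hasStrictFDerivAt_norm_sq v).hasFDerivAt.sqrt (by positivity)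
      have : (fun v : E => √(‖v‖ ^ 2)) = fun v => ‖v‖ := by
        ext v; exact Real.sqrt_sq (norm_nonneg _)
      rw [this] at h1
      convert h1 using 1
      ext w
      simp [Real.sqrt_sq]
      field_simp
    have h2 : HasFDerivAt (fun v : E => max 0 (s - ‖v‖)) (-(‖v‖⁻¹ • innerSL ℝ v)) v := by
      refine (hn.const_sub s).congr_of_eventuallyEq ?_
      have : ∀ᶠ w : E in nhds v, ‖w‖ < s := continuous_norm.continuousAt.eventually_lt_const h
      filter_upwards [this] with w hw
      exact max_eq_right (by linarith)
    rw [(h2.hasLineDerivAt (-e)).lineDeriv, Set.indicator_of_mem (by simpa using h)]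
    simp [inner_smul_left]
  · rw [Set.indicator_of_notMem (by simpa using h.le)]
    have h2 : HasFDerivAt (fun v : E => max 0 (s - ‖v‖)) (0 : E →L[ℝ] ℝ) v := by
      refine (hasFDerivAt_const (0:ℝ) v).congr_of_eventuallyEq ?_
      have : ∀ᶠ w : E in nhds v, s < ‖w‖ := continuous_norm.continuousAt.eventually_const_lt h
      filter_upwards [this] with w hw
      exact max_eq_left (by linarith)
    rw [(h2.hasLineDerivAt (-e)).lineDeriv]
    simp

lemma aux_ae_sphere (s : ℝ) : ∀ᵐ v : E ∂μ, ‖v‖ ≠ s := by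
  have := Measure.addHaar_sphere μ (0 : E) s
  rw [← compl_mem_ae_iff] at this
  filter_upwards [this] with v hv
  simpa using hv

lemma aux_ident {g : E → ℝ} {C : NNReal} (hg : LipschitzWith C g) (e : E) {s : ℝ} (hs : 0 < s) :
    ∫ v, lineDeriv ℝ g v e * max 0 (s - ‖v‖) ∂μ =
      ∫ t in (0:ℝ)..s, t ^ (Module.finrank ℝ E - 1) *
        ∫ u : sphere (0 : E) 1, inner ℝ (u : E) e * g (t • (u : E)) ∂μ.toSphere := by
  rw [hg.integral_lineDeriv_mul_eq (aux_lip s) (aux_supp s)]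
  have h1 : ∫ v, lineDeriv ℝ (fun v : E => max 0 (s - ‖v‖)) v (-e) * g v ∂μ =
      ∫ v, (ball (0 : E) s).indicator (fun v => inner ℝ (‖v‖⁻¹ • v) e * g v) v ∂μ := by
    apply integral_congr_ae
    filter_upwards [aux_ae_sphere μ s, aux_ae_sphere μ 0] with v h h0
    rw [aux_lineDeriv s e v (norm_ne_zero_iff.1 h0) h]
    by_cases hb : v ∈ ball (0 : E) s <;> simp [hb]
  rw [h1, aux_polar]
  · rw [intervalIntegral.integral_of_le hs.le, integral_Ioc_eq_integral_Ioo,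
      ← integral_indicator measurableSet_Ioi, ← integral_indicator measurableSet_Ioo]
    congr 1
    ext t
    by_cases ht : 0 < t
    · have hn : ∀ u : sphere (0 : E) 1, ‖t • (u : E)‖ = t := fun u => by
        simp [norm_smul, abs_of_pos ht]
      by_cases hts : t < s
      · simp only [Set.indicator, Set.mem_Ioi, Set.mem_Ioo, ht, hts, mem_ball, dist_zero_right, hn]
        simp [smul_smul, ht.ne']
      · simp only [Set.indicator, Set.mem_Ioi, Set.mem_Ioo, ht, hts, mem_ball, dist_zero_right, hn]
        simp
    · simp [Set.indicator, ht]
  · rw [integrable_indicator_iff measurableSet_ball]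
    have hgi : IntegrableOn g (ball (0:E) s) μ :=
      (hg.continuous.continuousOn.integrableOn_compact (isCompact_closedBall (0:E) s)).mono_set
        ball_subset_closedBall
    refine Integrable.bdd_mul (c := ‖e‖) hgi ?_ (.of_forall fun v => ?_)
    · exact (((measurable_norm.inv.smul measurable_id).inner_const)).aestronglyMeasurable
    · refine (norm_inner_le_norm _ _).trans ?_
      have : ‖‖v‖⁻¹ • v‖ ≤ 1 := by
        rw [norm_smul, norm_inv, norm_norm]; exact inv_mul_le_one
      nlinarith [norm_nonneg e]

lemma aux_div {g : E → ℝ} {C : NNReal} (hg : LipschitzWith C g) (e : E) :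
    ∫ v in closedBall (0 : E) 1, lineDeriv ℝ g v e ∂μ =
      ∫ u : sphere (0 : E) 1, inner ℝ (u : E) e * g (u : E) ∂μ.toSphere := by
  set J : ℝ → ℝ := fun t => t ^ (Module.finrank ℝ E - 1) *
        ∫ u : sphere (0 : E) 1, inner ℝ (u : E) e * g (t • (u : E)) ∂μ.toSphere with hJ
  have hJc : Continuous J := by
    refine (continuous_pow _).mul ?_
    have hgc := hg.continuous
    have : Continuous fun t : ℝ => ∫ u in (Set.univ : Set (sphere (0 : E) 1)),
        inner ℝ (u : E) e * g (t • (u : E)) ∂μ.toSphere := by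
      apply continuous_parametric_integral_of_continuous _ isCompact_univ
      simp only [Function.uncurry_def]
      fun_prop
    simpa using this
  have hR : HasDerivAt (fun s => ∫ t in (0:ℝ)..s, J t) (J 1) 1 :=
    intervalIntegral.integral_hasDerivAt_right (hJc.intervalIntegrable _ _)
      (hJc.stronglyMeasurableAtFilter _ _) hJc.continuousAt
  have hmeas : Measurable fun v => lineDeriv ℝ g v e := measurable_lineDeriv hg.continuous
  have hbd : ∀ v, ‖lineDeriv ℝ g v e‖ ≤ C * ‖e‖ := fun v => norm_lineDeriv_le_of_lipschitz ℝ hg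
  have hLd : HasDerivAt (fun s => ∫ v, lineDeriv ℝ g v e * max 0 (s - ‖v‖) ∂μ)
      (∫ v, (closedBall (0 : E) 1).indicator (fun v => lineDeriv ℝ g v e) v ∂μ) 1 := by
    refine (hasDerivAt_integral_of_dominated_loc_of_lip (s := Set.Ioo (0:ℝ) 2)
      (bound := (closedBall (0 : E) 2).indicator fun _ => C * ‖e‖)
      (Ioo_mem_nhds (by norm_num) (by norm_num)) ?_ ?_ ?_ ?_ ?_ ?_).2
    · exact .of_forall fun s => by
        exact (hmeas.mul (aux_lip s).continuous.measurable).aestronglyMeasurable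
    · exact (((aux_lip (1:ℝ)).continuous.integrable_of_hasCompactSupport
        (aux_supp 1)).bdd_mul (c := C * ‖e‖) hmeas.aestronglyMeasurable (.of_forall hbd))
    · exact (hmeas.indicator measurableSet_closedBall).aestronglyMeasurable
    · refine .of_forall fun v => LipschitzOnWith.of_dist_le_mul fun a ha b hb => ?_
      by_cases hv : v ∈ closedBall (0 : E) 2
      · simp only [hv, Set.indicator_of_mem, Real.coe_nnabs]
        rw [Real.dist_eq, Real.dist_eq, ← mul_sub, abs_mul]
        refine mul_le_mul ((hbd v).trans (le_abs_self _)) ?_ (abs_nonneg _) (abs_nonneg _)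
        have h := abs_max_sub_max_le_max 0 (a - ‖v‖) 0 (b - ‖v‖)
        simpa using h
      · have hv' : 2 < ‖v‖ := by simpa using hv
        rw [max_eq_left (by linarith [ha.2]), max_eq_left (by linarith [hb.2])]
        simp [hv]
    · rw [integrable_indicator_iff measurableSet_closedBall]
      exact integrableOn_const (isCompact_closedBall (0:E) 2).measure_lt_top.ne
    · filter_upwards [aux_ae_sphere μ 1] with v hv
      rcases lt_or_gt_of_ne hv with h | h
      · rw [Set.indicator_of_mem (by simpa using h.le)]
        have : HasDerivAt (fun s : ℝ => lineDeriv ℝ g v e * (s - ‖v‖)) (lineDeriv ℝ g v e * 1) 1 :=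
          ((hasDerivAt_id (1:ℝ)).sub_const _).const_mul _
        rw [mul_one] at this
        refine this.congr_of_eventuallyEq ?_
        filter_upwards [Ioi_mem_nhds h] with s hs
        rw [max_eq_right (sub_nonneg.2 (le_of_lt hs))]
      · rw [Set.indicator_of_notMem (by simpa using h)]
        refine (hasDerivAt_const (1:ℝ) (0:ℝ)).congr_of_eventuallyEq ?_
        filter_upwards [Iio_mem_nhds h] with s hs
        rw [max_eq_left (sub_nonpos.2 (le_of_lt hs)), mul_zero]
  have hEq : (fun s => ∫ v, lineDeriv ℝ g v e * max 0 (s - ‖v‖) ∂μ) =ᶠ[nhds 1]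
      (fun s => ∫ t in (0:ℝ)..s, J t) := by
    filter_upwards [Ioi_mem_nhds (zero_lt_one (α := ℝ))] with s hs
    exact aux_ident μ hg e hs
  have := hLd.unique (hR.congr_of_eventuallyEq hEq)
  rw [integral_indicator measurableSet_closedBall] at this
  rw [this, hJ]
  simp

lemma aux_fderiv {f : E → ℝ} {L : NNReal} (hf : LipschitzWith L f) {r : ℝ} (hr : 0 < r) (x : E) :
    IntegrableOn (fun v => fderiv ℝ f (x + r • v)) (closedBall (0 : E) 1) μ ∧
    HasFDerivAt (fun y => ∫ v in closedBall (0 : E) 1, f (y + r • v) ∂μ)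
      (∫ v in closedBall (0 : E) 1, fderiv ℝ f (x + r • v) ∂μ) x := by
  have hfc := hf.continuous
  refine hasFDerivAt_integral_of_dominated_loc_of_lip (bound := fun _ => (L : ℝ)) Filter.univ_mem
    (.of_forall fun y => ?_) ?_ ?_ ?_ ?_ ?_
  · exact (by fun_prop : Continuous fun v => f (y + r • v)).aestronglyMeasurable
  · exact (by fun_prop : Continuous fun v => f (x + r • v)).continuousOn.integrableOn_compact
      (isCompact_closedBall (0:E) 1)
  · exact ((measurable_fderiv ℝ f).comp
      (by fun_prop : Measurable fun v : E => x + r • v)).aestronglyMeasurable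
  · refine .of_forall fun v => LipschitzOnWith.of_dist_le_mul fun a _ b _ => ?_
    simpa using hf.dist_le_mul (a + r • v) (b + r • v)
  · exact integrableOn_const (isCompact_closedBall (0:E) 1).measure_lt_top.ne
  · apply ae_restrict_of_ae
    have hg : LipschitzWith (L * r.toNNReal) fun v => f (x + r • v) := by
      refine LipschitzWith.of_dist_le_mul fun a b => ?_
      refine (hf.dist_le_mul _ _).trans ?_
      simp [dist_smul₀, abs_of_pos hr, hr.le, mul_assoc]
    filter_upwards [hg.ae_differentiableAt (μ := μ)] with v hv
    have hd : DifferentiableAt ℝ f (x + r • v) := by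
      have h1 : f = (fun v => f (x + r • v)) ∘ fun z => r⁻¹ • (z - x) := by
        ext z; simp [smul_smul, hr.ne']
      rw [h1]
      apply DifferentiableAt.comp
      · simpa [smul_smul, hr.ne'] using hv
      · fun_prop
    have := hd.hasFDerivAt
    rw [← hasFDerivAt_comp_add_right] at this
    exact this

end aux

/-- one-point zeroth-order gradient estimation identity.
If `f : ℝ^d → ℝ` is Lipschitz and `r > 0`, then the ball-smoothed function
`f̂ x = 𝔼_{v ∼ Uni(𝔹_d)} [f (x + r v)]` is differentiable at every `x`, with gradient
`∇ f̂ x = (d / r) • 𝔼_{u ∼ Uni(𝕊_{d-1})} [f (x + r u) • u]`. -/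
theorem stmt_0 {d : ℕ} (hd : 1 ≤ d) {r : ℝ} (hr : 0 < r)
    (f : EuclideanSpace ℝ (Fin d) → ℝ) (L : NNReal) (hf : LipschitzWith L f)
    (x : EuclideanSpace ℝ (Fin d)) :
    HasGradientAt (fun y => ∫ v, f (y + r • v) ∂(unifBall d))
      (((d : ℝ) / r) •
        ∫ u : sphere (0 : EuclideanSpace ℝ (Fin d)) 1,
          f (x + r • (u : EuclideanSpace ℝ (Fin d))) • (u : EuclideanSpace ℝ (Fin d))
            ∂(unifSphere d)) x := by
  have hfr : Module.finrank ℝ (EuclideanSpace ℝ (Fin d)) = d := by simp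
  have : Nontrivial (EuclideanSpace ℝ (Fin d)) :=
    Module.nontrivial_of_finrank_pos (R := ℝ) (by rw [hfr]; exact hd)
  have hfc := hf.continuous
  have hd0 : (d : ℝ) ≠ 0 := by positivity
  obtain ⟨hi, hD⟩ := aux_fderiv volume hf hr x
  have hb : volume.real (closedBall (0 : EuclideanSpace ℝ (Fin d)) 1) ≠ 0 :=
    (ENNReal.toReal_pos (measure_closedBall_pos volume _ one_pos).ne'
      (isCompact_closedBall _ _).measure_lt_top.ne).ne'
  have hS : ((volume : Measure (EuclideanSpace ℝ (Fin d))).toSphere Set.univ).toReal =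
      d * volume.real (closedBall (0 : EuclideanSpace ℝ (Fin d)) 1) := by
    have := (volume : Measure (EuclideanSpace ℝ (Fin d))).toSphere_real_apply_univ
    rw [hfr] at this
    rw [measureReal_def, measureReal_def] at this
    rw [measureReal_def, Measure.addHaar_closedBall_eq_addHaar_ball, this]
  have hg : LipschitzWith (L * r.toNNReal) fun v => f (x + r • v) := by
    refine LipschitzWith.of_dist_le_mul fun a b => ?_
    refine (hf.dist_le_mul _ _).trans ?_
    simp [dist_smul₀, abs_of_pos hr, hr.le, mul_assoc]
  rw [hasGradientAt_iff_hasFDerivAt]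
  simp only [unifBall, unifSphere, integral_smul_measure, ENNReal.toReal_inv, hS]
  refine (hD.const_smul
    (volume.real (closedBall (0 : EuclideanSpace ℝ (Fin d)) 1))⁻¹).congr_fderiv ?_
  refine ContinuousLinearMap.ext fun e => Eq.symm ?_
  have hdiv := aux_div volume hg e
  have hl : ∫ v in closedBall (0 : EuclideanSpace ℝ (Fin d)) 1,
      lineDeriv ℝ (fun v => f (x + r • v)) v e =
      r * ∫ v in closedBall (0 : EuclideanSpace ℝ (Fin d)) 1, fderiv ℝ f (x + r • v) e := by
    rw [← integral_const_mul]
    apply integral_congr_ae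
    apply ae_restrict_of_ae
    filter_upwards [hg.ae_differentiableAt (μ := volume)] with v hv
    have hd : DifferentiableAt ℝ f (x + r • v) := by
      have h1 : f = (fun v => f (x + r • v)) ∘ fun z => r⁻¹ • (z - x) := by
        ext z; simp [smul_smul, hr.ne']
      rw [h1]
      apply DifferentiableAt.comp
      · simpa [smul_smul, hr.ne'] using hv
      · fun_prop
    have h2 : HasFDerivAt (fun v : EuclideanSpace ℝ (Fin d) => x + r • v)
        (r • ContinuousLinearMap.id ℝ _) v := ((hasFDerivAt_id v).const_smul r).const_add x
    have h3 := (hd.hasFDerivAt.comp v h2).hasLineDerivAt e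
    have h4 := h3.lineDeriv
    simpa [Function.comp_def] using h4
  have hint : Integrable (fun u : sphere (0 : EuclideanSpace ℝ (Fin d)) 1 =>
      f (x + r • (u : EuclideanSpace ℝ (Fin d))) • (u : EuclideanSpace ℝ (Fin d)))
      (volume : Measure (EuclideanSpace ℝ (Fin d))).toSphere := by
    have hc : Continuous (fun u : sphere (0 : EuclideanSpace ℝ (Fin d)) 1 =>
      f (x + r • (u : EuclideanSpace ℝ (Fin d))) • (u : EuclideanSpace ℝ (Fin d))) := by fun_prop
    exact hc.integrable_of_hasCompactSupport (HasCompactSupport.of_compactSpace _)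
  have hin : inner ℝ (∫ u : sphere (0 : EuclideanSpace ℝ (Fin d)) 1,
      f (x + r • (u : EuclideanSpace ℝ (Fin d))) • (u : EuclideanSpace ℝ (Fin d))
      ∂(volume : Measure (EuclideanSpace ℝ (Fin d))).toSphere) e =
      ∫ u : sphere (0 : EuclideanSpace ℝ (Fin d)) 1,
        inner ℝ (u : EuclideanSpace ℝ (Fin d)) e * f (x + r • (u : EuclideanSpace ℝ (Fin d)))
      ∂(volume : Measure (EuclideanSpace ℝ (Fin d))).toSphere := by
    rw [real_inner_comm, ← integral_inner hint]
    congr 1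
    ext u
    rw [inner_smul_right, real_inner_comm, mul_comm]
  rw [InnerProductSpace.toDual_apply_apply, inner_smul_left, inner_smul_left, hin, ← hdiv, hl,
    ContinuousLinearMap.smul_apply, ContinuousLinearMap.integral_apply hi]
  simp only [smul_eq_mul, conj_trivial]
  field_simp
end

section
/- Let f : ℝ^d → ℝ be Lipschitz continuous on the ball {y : ‖y − x‖ ≤ β}, differentiable there, and suppose ‖∇f(y) − ∇f(x)‖ ≤ φ‖y − x‖ for all y with ‖y − x‖ ≤ β, where φ, β > 0. Then for every r with 0 < r ≤ β: ‖ (d/r) · E_{u∼Uni(𝕊_{d−1})}[f(x + r u) u] − ∇f(x) ‖ ≤ φ r. -/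
open MeasureTheory Metric

section helpers

set_option linter.unusedSectionVars false

variable {E : Type*} [NormedAddCommGroup E] [InnerProductSpace ℝ E] [FiniteDimensional ℝ E]
  [MeasurableSpace E] [BorelSpace E] (μ : Measure E) [μ.IsAddHaarMeasure]

lemma polar_aux (ψ : ℝ → ℝ) (Ψ : sphere (0 : E) 1 → ℝ) (F : E → ℝ)
    (hF : ∀ u : sphere (0 : E) 1, ∀ s : ℝ, 0 < s → F (s • (u : E)) = Ψ u * ψ s) [Nontrivial E] :
    ∫ y, F y ∂μ = (∫ u, Ψ u ∂μ.toSphere) *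
      ∫ s in Set.Ioi (0 : ℝ), s ^ (Module.finrank ℝ E - 1) * ψ s := by
  calc
    ∫ y, F y ∂μ = ∫ y : ({(0)}ᶜ : Set E), F y.1 ∂(μ.comap (↑)) := by
      rw [integral_subtype_comap (measurableSet_singleton _).compl F,
        restrict_compl_singleton]
    _ = ∫ z, Ψ z.1 * ψ z.2 ∂μ.toSphere.prod (.volumeIoiPow (Module.finrank ℝ E - 1)) := by
      rw [← μ.measurePreserving_homeomorphUnitSphereProd.integral_comp
        (Homeomorph.measurableEmbedding _)
        (fun z : sphere (0 : E) 1 × Set.Ioi (0 : ℝ) => Ψ z.1 * ψ z.2)]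
      refine integral_congr_ae (Filter.Eventually.of_forall fun y => ?_)
      have h := hF (homeomorphUnitSphereProd E y).1 (homeomorphUnitSphereProd E y).2
        (homeomorphUnitSphereProd E y).2.2
      simp only
      rw [← h]
      congr 1
      have hy : ‖(y : E)‖ ≠ 0 := norm_ne_zero_iff.2 y.2
      simp [smul_smul, hy]
    _ = (∫ u, Ψ u ∂μ.toSphere) *
        ∫ s : Set.Ioi (0 : ℝ), ψ s ∂.volumeIoiPow (Module.finrank ℝ E - 1) :=
      integral_prod_mul Ψ (fun s : Set.Ioi (0 : ℝ) => ψ s)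
    _ = _ := by
      simp only [Measure.volumeIoiPow, ENNReal.ofReal]
      rw [integral_withDensity_eq_integral_smul,
        integral_subtype_comap measurableSet_Ioi
          fun a ↦ Real.toNNReal (a ^ (Module.finrank ℝ E - 1)) • ψ a,
        setIntegral_congr_fun measurableSet_Ioi fun x hx ↦ ?_]
      · simp only [NNReal.smul_def, Real.coe_toNNReal _ (pow_nonneg (le_of_lt hx) _), smul_eq_mul]
      · exact (measurable_subtype_coe.pow_const _).real_toNNReal

/-- radial cutoff -/
noncomputable def cutg (a b : ℝ) (y : E) : ℝ := max 0 (min (b - a) (b - ‖y‖))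

lemma cutg_lip (a b : ℝ) : LipschitzWith 1 (cutg (E := E) a b) := by
  have h : LipschitzWith 1 (fun y : E => b - ‖y‖) := by
    refine LipschitzWith.of_dist_le_mul fun y z => ?_
    have := abs_norm_sub_norm_le z y
    rw [Real.dist_eq, dist_eq_norm, NNReal.coe_one, one_mul, norm_sub_rev y z]
    convert this using 2
    ring
  exact (h.const_min (b - a)).const_max 0

lemma cutg_supp (a b : ℝ) : HasCompactSupport (cutg (E := E) a b) := by
  refine HasCompactSupport.intro (isCompact_closedBall (0 : E) b) fun y hy => ?_
  have : b < ‖y‖ := by simpa using hy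
  unfold cutg
  exact max_eq_left ((min_le_right _ _).trans (by linarith))

lemma norm_lineDeriv_aux (y v : E) (hy : y ≠ 0) :
    HasLineDerivAt ℝ (fun z : E => ‖z‖) (inner ℝ y v / ‖y‖) y v := by
  have h1 : HasFDerivAt (fun z : E => ‖z‖ ^ 2) (2 • (innerSL ℝ y)) y :=
    (hasStrictFDerivAt_norm_sq y).hasFDerivAt
  have h2 := (h1.sqrt (pow_ne_zero 2 (norm_ne_zero_iff.2 hy))).hasLineDerivAt v
  have hy' : ‖y‖ ≠ 0 := norm_ne_zero_iff.2 hy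
  simp only [Real.sqrt_sq (norm_nonneg _)] at h2
  convert h2 using 1
  simp
  field_simp

lemma cutg_deriv (a b : ℝ) (ha : 0 ≤ a) (hab : a < b) (y v : E) (hya : ‖y‖ ≠ a) (hyb : ‖y‖ ≠ b) :
    lineDeriv ℝ (cutg a b) y (-v) =
      (Set.Ioo a b).indicator (fun _ => (1 : ℝ)) ‖y‖ * (inner ℝ y v / ‖y‖) := by
  have cn : Filter.Tendsto (fun z : E => ‖z‖) (nhds y) (nhds ‖y‖) := continuous_norm.tendsto y
  rcases lt_or_gt_of_ne hya with h | h
  · have : cutg a b =ᶠ[nhds y] fun _ => b - a := by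
      filter_upwards [cn.eventually (gt_mem_nhds h)] with z hz
      unfold cutg
      rw [min_eq_left (by linarith), max_eq_right (by linarith)]
    rw [this.lineDeriv_eq, show ∀ c : ℝ, lineDeriv ℝ (fun _ : E => c) y (-v) = 0 from fun c => by simp [lineDeriv]]
    rw [Set.indicator_of_notMem (fun h' => by have := h'.1; linarith)]; simp
  rcases lt_or_gt_of_ne hyb with h' | h'
  · have : cutg a b =ᶠ[nhds y] fun z => b - ‖z‖ := by
      filter_upwards [cn.eventually (lt_mem_nhds h), cn.eventually (gt_mem_nhds h')] with z hz hz'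
      unfold cutg
      rw [min_eq_right (by linarith), max_eq_right (by linarith)]
    have hy : y ≠ 0 := by
      rintro rfl
      simp at h; linarith
    rw [this.lineDeriv_eq, Set.indicator_of_mem (show ‖y‖ ∈ Set.Ioo a b from ⟨h, h'⟩)]
    have h3 := norm_lineDeriv_aux y (-v) hy
    have h4 : HasLineDerivAt ℝ (fun z : E => b - ‖z‖) (-(inner ℝ y (-v) / ‖y‖)) y (-v) :=
      HasDerivAt.const_sub b h3
    rw [h4.lineDeriv]
    simp [inner_neg_right, neg_div]
  · have : cutg a b =ᶠ[nhds y] fun _ => 0 := by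
      filter_upwards [cn.eventually (lt_mem_nhds h')] with z hz
      unfold cutg
      exact max_eq_left ((min_le_right _ _).trans (by linarith))
    rw [this.lineDeriv_eq, show ∀ c : ℝ, lineDeriv ℝ (fun _ : E => c) y (-v) = 0 from fun c => by simp [lineDeriv]]
    rw [Set.indicator_of_notMem (fun h'' => by have := h''.2; linarith)]; simp

lemma parts [Nontrivial E] (a b : ℝ) (ha : 0 ≤ a) (hab : a < b) (v : E) (F : E → ℝ) (C : NNReal)
    (hF : LipschitzWith C F) (p : ℕ) (Ψ : sphere (0 : E) 1 → ℝ)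
    (hΨ : ∀ u : sphere (0 : E) 1, ∀ s ∈ Set.Ioo a b, F (s • (u : E)) = s ^ p * Ψ u) :
    ∫ y, lineDeriv ℝ F y v * cutg a b y ∂μ =
      (∫ u, Ψ u * inner ℝ (u : E) v ∂μ.toSphere) *
      ∫ s in a..b, s ^ (Module.finrank ℝ E - 1 + p) := by
  rw [hF.integral_lineDeriv_mul_eq (cutg_lip a b) (cutg_supp a b)]
  have : ∀ᵐ y ∂μ, lineDeriv ℝ (cutg a b) y (-v) * F y =
      (Set.Ioo a b).indicator (fun _ => (1 : ℝ)) ‖y‖ * (inner ℝ y v / ‖y‖) * F y := by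
    have h1 : ∀ᵐ y ∂μ, y ∉ sphere (0 : E) a := measure_eq_zero_iff_ae_notMem.1 (Measure.addHaar_sphere μ 0 a)
    have h2 : ∀ᵐ y ∂μ, y ∉ sphere (0 : E) b := measure_eq_zero_iff_ae_notMem.1 (Measure.addHaar_sphere μ 0 b)
    filter_upwards [h1, h2] with y hy1 hy2
    rw [cutg_deriv a b ha hab y v (by simpa using hy1) (by simpa using hy2)]
  rw [integral_congr_ae this, polar_aux μ (fun s => (Set.Ioo a b).indicator (fun s => s ^ p) s)
    (fun u => Ψ u * inner ℝ (u : E) v)]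
  · congr 1
    have : ∀ s : ℝ, s ^ (Module.finrank ℝ E - 1) * (Set.Ioo a b).indicator (fun s => s ^ p) s =
      (Set.Ioo a b).indicator (fun s => s ^ (Module.finrank ℝ E - 1 + p)) s := by
      intro s
      by_cases hs : s ∈ Set.Ioo a b
      · simp [hs, pow_add]
      · simp [hs]
    simp only [this]
    rw [setIntegral_indicator measurableSet_Ioo, intervalIntegral.integral_of_le hab.le,
      integral_Ioc_eq_integral_Ioo]
    congr 2
    ext s
    simp only [Set.mem_inter_iff, Set.mem_Ioi, Set.mem_Ioo]
    constructor
    · exact fun h => h.2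
    · exact fun h => ⟨by linarith [h.1], h⟩
  · intro u s hs
    have hu : ‖(u : E)‖ = 1 := by simp
    have hn : ‖s • (u : E)‖ = s := by rw [norm_smul, hu]; simp [abs_of_pos hs]
    rw [hn]
    by_cases h : s ∈ Set.Ioo a b
    · rw [hΨ u s h]
      simp only [h, Set.indicator_of_mem, inner_smul_left]
      simp
      field_simp
    · simp [h]

lemma lin_part [Nontrivial E] (w v : E) :
    ∫ u : sphere (0 : E) 1, inner ℝ w (u : E) * inner ℝ (u : E) v ∂μ.toSphere =
      μ.real (ball 0 1) * inner ℝ w v := by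
  have hl : LipschitzWith ‖innerSL ℝ w‖₊ (fun y : E => inner ℝ w y) :=
    (innerSL ℝ w).lipschitz
  have h := parts μ 0 1 le_rfl one_pos v (fun y => inner ℝ w y) _ hl 1
    (fun u => inner ℝ w (u : E)) (fun u s hs => by simp [inner_smul_right])
  have hd : ∀ y, lineDeriv ℝ (fun y : E => inner ℝ w y) y v = inner ℝ w v := fun y =>
    ((innerSL ℝ w).hasFDerivAt.hasLineDerivAt v).lineDeriv
  simp only [hd] at h
  rw [integral_const_mul] at h
  have hn : 0 < Module.finrank ℝ E := Module.finrank_pos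
  have hg : ∫ y : E, cutg 0 1 y ∂μ = μ.real (ball 0 1) / (Module.finrank ℝ E + 1) := by
    have := integral_fun_norm_addHaar μ (fun s => max 0 (min (1 - 0) (1 - s)))
    unfold cutg
    rw [this]
    have h1 : ∫ s in Set.Ioi (0:ℝ), s ^ (Module.finrank ℝ E - 1) • max 0 (min (1 - 0) (1 - s)) =
        ∫ s in (0:ℝ)..1, (s ^ (Module.finrank ℝ E - 1) - s ^ (Module.finrank ℝ E)) := by
      rw [intervalIntegral.integral_of_le zero_le_one]
      symm
      rw [setIntegral_eq_of_subset_of_forall_sdiff_eq_zero (t := Set.Ioi (0:ℝ)) (s := Set.Ioc 0 1)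
        (f := fun s => s ^ (Module.finrank ℝ E - 1) • max 0 (min (1 - 0) (1 - s)))
        measurableSet_Ioi (fun s hs => hs.1)]
      · refine setIntegral_congr_fun measurableSet_Ioc fun s hs => ?_
        have e : s ^ (Module.finrank ℝ E) = s ^ (Module.finrank ℝ E - 1) * s := by
          rw [← pow_succ]; congr 1; omega
        rw [min_eq_right (by linarith [hs.1]), max_eq_right (by linarith [hs.2]), e, smul_eq_mul]
        ring
      · intro s hs
        have : 1 < s := by
          by_contra hc
          exact hs.2 ⟨hs.1, not_lt.1 hc⟩
        rw [max_eq_left ((min_le_right _ _).trans (by linarith))]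
        simp
    rw [h1, intervalIntegral.integral_sub (by simp) (by simp), integral_pow, integral_pow]
    obtain ⟨m, hm⟩ : ∃ m, Module.finrank ℝ E = m + 1 := ⟨_, (Nat.succ_pred_eq_of_pos hn).symm⟩
    rw [hm]
    simp
    field_simp
    ring
  rw [hg, Nat.sub_add_cancel hn, integral_pow] at h
  have hn' : (Module.finrank ℝ E : ℝ) + 1 ≠ 0 := by positivity
  simp at h
  field_simp at h
  linarith

lemma proj_lip : LipschitzWith 1 (fun y : E => (max 1 ‖y‖)⁻¹ • y) := by
  have hn : ∀ y : E, ‖(max 1 ‖y‖)⁻¹ • y‖ ≤ 1 := by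
    intro y
    have h1 : 0 < max 1 ‖y‖ := lt_max_of_lt_left one_pos
    rw [norm_smul, norm_inv, Real.norm_of_nonneg h1.le, inv_mul_le_one₀ h1]
    exact le_max_right _ _
  have key : ∀ y q : E, ‖q‖ ≤ 1 →
      inner ℝ (y - (max 1 ‖y‖)⁻¹ • y) (q - (max 1 ‖y‖)⁻¹ • y) ≤ 0 := by
    intro y q hq
    rcases le_total ‖y‖ 1 with h | h
    · simp [max_eq_left h]
    · rw [max_eq_right h]
      have hy : ‖y‖ ≠ 0 := by linarith
      set p := ‖y‖⁻¹ • y with hp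
      have hp1 : ‖p‖ = 1 := by rw [hp, norm_smul]; simp [hy]
      have : y - p = (‖y‖ - 1) • p := by
        rw [sub_smul, one_smul, hp, smul_smul, mul_inv_cancel₀ hy, one_smul]
      rw [this, real_inner_smul_left, inner_sub_right, real_inner_self_eq_norm_sq, hp1]
      have h2 : inner ℝ p q ≤ 1 := (real_inner_le_norm p q).trans (by rw [hp1, one_mul]; exact hq)
      nlinarith
  refine LipschitzWith.of_dist_le_mul fun y z => ?_
  have k1 := key y _ (hn z)
  have k2 := key z _ (hn y)
  simp only [dist_eq_norm, NNReal.coe_one, one_mul]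
  set p := (max 1 ‖y‖)⁻¹ • y
  set q := (max 1 ‖z‖)⁻¹ • z
  have h3 : ‖p - q‖ ^ 2 ≤ inner ℝ (y - z) (p - q) := by
    rw [← real_inner_self_eq_norm_sq]
    simp only [inner_sub_left, inner_sub_right] at k1 k2 ⊢
    linarith
  have h4 := real_inner_le_norm (y - z) (p - q)
  by_contra hc
  push Not at hc
  nlinarith [norm_nonneg (p - q), norm_nonneg (y - z)]

lemma k_part [Nontrivial E] (k : E → ℝ) (M : NNReal) (hk : LipschitzOnWith M k (closedBall 0 1))
    (v : E) :
    |∫ u : sphere (0 : E) 1, k u * inner ℝ (u : E) v ∂μ.toSphere| ≤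
      M * ‖v‖ * μ.real (ball 0 1) := by
  set I := ∫ u : sphere (0 : E) 1, k u * inner ℝ (u : E) v ∂μ.toSphere with hI
  set n := Module.finrank ℝ E
  have hL : LipschitzWith M (fun y : E => k ((max 1 ‖y‖)⁻¹ • y)) := by
    have h := hk.comp (proj_lip (E := E)).lipschitzOnWith (s := Set.univ) (fun y _ => by
      have h1 : 0 < max 1 ‖y‖ := lt_max_of_lt_left one_pos
      rw [mem_closedBall_zero_iff, norm_smul, norm_inv, Real.norm_of_nonneg h1.le,
        inv_mul_le_one₀ h1]
      exact le_max_right _ _)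
    rw [mul_one, lipschitzOnWith_univ] at h
    exact h
  have main : ∀ ε : ℝ, 0 < ε → |I| ≤ M * ‖v‖ * μ.real (ball 0 1) * (1 + ε) ^ n := by
    intro ε hε
    have h := parts μ 1 (1 + ε) zero_le_one (by linarith) v _ M hL 0 (fun u => k u)
      (fun u s hs => by
        have hu : ‖(u : E)‖ = 1 := by simp
        have hs0 : 0 < s := by linarith [hs.1]
        have hn : ‖s • (u : E)‖ = s := by rw [norm_smul, hu]; simp [abs_of_pos hs0]
        rw [hn, max_eq_right hs.1.le, smul_smul, inv_mul_cancel₀ hs0.ne']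
        simp)
    rw [← hI] at h
    have hJ : ε ≤ ∫ s in (1:ℝ)..(1 + ε), s ^ (n - 1 + 0) := by
      calc ε = ∫ s in (1:ℝ)..(1 + ε), (1:ℝ) := by simp
        _ ≤ _ := intervalIntegral.integral_mono_on (by linarith) (by simp) (by simp)
          (fun s hs => one_le_pow₀ hs.1)
    have hB : ‖∫ y, lineDeriv ℝ (fun y : E => k ((max 1 ‖y‖)⁻¹ • y)) y v * cutg 1 (1 + ε) y ∂μ‖
        ≤ (M * ‖v‖ * ε) * μ.real (closedBall (0:E) (1 + ε)) := by
      rw [← setIntegral_eq_integral_of_forall_compl_eq_zero (s := closedBall (0:E) (1 + ε))]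
      · refine norm_setIntegral_le_of_norm_le_const measure_closedBall_lt_top fun y _ => ?_
        rw [norm_mul]
        have h1 := norm_lineDeriv_le_of_lipschitz ℝ (x₀ := y) (v := v) hL
        have h2 : ‖cutg 1 (1 + ε) y‖ ≤ ε := by
          unfold cutg
          rw [Real.norm_of_nonneg (le_max_left _ _)]
          exact max_le hε.le ((min_le_left _ _).trans (by linarith))
        exact mul_le_mul h1 h2 (norm_nonneg _) (by positivity)
      · intro y hy
        have : 1 + ε < ‖y‖ := by simpa using hy
        unfold cutg
        rw [max_eq_left ((min_le_right _ _).trans (by linarith)), mul_zero]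
    rw [Measure.addHaar_real_closedBall μ _ (by linarith : (0:ℝ) ≤ 1 + ε), h, norm_mul,
      Real.norm_eq_abs, Real.norm_of_nonneg (hε.le.trans hJ)] at hB
    have h5 : |I| * ε ≤ |I| * ∫ s in (1:ℝ)..(1 + ε), s ^ (n - 1 + 0) :=
      mul_le_mul_of_nonneg_left hJ (abs_nonneg _)
    refine le_of_mul_le_mul_right (h5.trans (hB.trans (le_of_eq ?_))) hε
    ring
  have ht : Filter.Tendsto (fun ε : ℝ => M * ‖v‖ * μ.real (ball (0:E) 1) * (1 + ε) ^ n)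
      (nhdsWithin 0 (Set.Ioi 0)) (nhds (M * ‖v‖ * μ.real (ball (0:E) 1))) := by
    have : Continuous (fun ε : ℝ => M * ‖v‖ * μ.real (ball (0:E) 1) * (1 + ε) ^ n) := by fun_prop
    have h := this.tendsto 0
    simp only [add_zero, one_pow, mul_one] at h
    exact h.mono_left nhdsWithin_le_nhds
  exact ge_of_tendsto ht (by filter_upwards [self_mem_nhdsWithin] with ε hε using main ε hε)

end helpers

/-- bias of the one-point spherical gradient estimate, Lemmas 1–2.
If `f` is Lipschitz and differentiable on the ball of radius `β` around `x` with
`‖∇f(y) − ∇f(x)‖ ≤ φ‖y − x‖` there, then for every `0 < r ≤ β`,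
`‖(d/r) 𝔼_{u∼Uni(𝕊_{d−1})}[f(x + r u) u] − ∇f(x)‖ ≤ φ r`. -/
theorem stmt_13 {d : ℕ} (f : EuclideanSpace ℝ (Fin d) → ℝ)
    (x : EuclideanSpace ℝ (Fin d)) (φ β : ℝ) (hφ : 0 < φ) (hβ : 0 < β)
    (L : NNReal) (hflip : LipschitzOnWith L f (closedBall x β))
    (hdiff : ∀ y ∈ closedBall x β, DifferentiableAt ℝ f y)
    (hglip : ∀ y ∈ closedBall x β, ‖gradient f y - gradient f x‖ ≤ φ * ‖y - x‖)
    (r : ℝ) (hr : 0 < r) (hrβ : r ≤ β) :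
    ‖(((d : ℝ) / r) •
        ∫ u : sphere (0 : EuclideanSpace ℝ (Fin d)) 1,
          f (x + r • (u : EuclideanSpace ℝ (Fin d))) • (u : EuclideanSpace ℝ (Fin d))
            ∂(unifSphere d)) - gradient f x‖ ≤ φ * r := by
  rcases Nat.eq_zero_or_pos d with hd | hd
  · subst hd
    have : ∀ z : EuclideanSpace ℝ (Fin 0), ‖z‖ = 0 := fun z => by
      rw [Subsingleton.elim z 0, norm_zero]
    rw [this]
    positivity
  have : Nonempty (Fin d) := ⟨⟨0, hd⟩⟩
  set w := gradient f x with hw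
  set V := (volume : Measure (EuclideanSpace ℝ (Fin d))).real (ball 0 1) with hV
  have hVpos : 0 < V := by
    rw [hV, measureReal_def]
    exact ENNReal.toReal_pos (measure_ball_pos _ _ one_pos).ne' measure_ball_lt_top.ne
  set k : EuclideanSpace ℝ (Fin d) → ℝ := fun y => f (x + r • y) - r * inner ℝ w y with hkdef
  have hmem : ∀ y ∈ closedBall (0 : EuclideanSpace ℝ (Fin d)) 1, x + r • y ∈ closedBall x β := by
    intro y hy
    rw [mem_closedBall_zero_iff] at hy
    rw [mem_closedBall_iff_norm, add_sub_cancel_left, norm_smul, Real.norm_of_nonneg hr.le]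
    nlinarith
  have hM : 0 ≤ φ * r ^ 2 := by positivity
  have hk : LipschitzOnWith (Real.toNNReal (φ * r ^ 2)) k (closedBall 0 1) := by
    refine (convex_closedBall _ _).lipschitzOnWith_of_nnnorm_hasFDerivWithin_le
      (f' := fun y => r • innerSL ℝ (gradient f (x + r • y) - w)) (𝕜 := ℝ) (fun y hy => ?_)
      (fun y hy => ?_)
    · have h1 := (hdiff _ (hmem y hy)).hasGradientAt.hasFDerivAt
      have h2 : HasFDerivAt (fun y : EuclideanSpace ℝ (Fin d) => x + r • y)
          (r • ContinuousLinearMap.id ℝ _) y :=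
        ((hasFDerivAt_id y).const_smul r).const_add x
      have h3 := (h1.comp y h2).sub (((innerSL ℝ w).hasFDerivAt (x := y)).const_mul r)
      refine HasFDerivAt.hasFDerivWithinAt ?_
      refine HasFDerivAt.congr_fderiv (f := k) h3 ?_
      refine ContinuousLinearMap.ext (fun z : EuclideanSpace ℝ (Fin d) => ?_)
      simp [inner_sub_left, inner_smul_right]
      ring
    · rw [← NNReal.coe_le_coe]
      rw [Real.coe_toNNReal _ hM, coe_nnnorm]
      rw [norm_smul, innerSL_apply_norm, Real.norm_of_nonneg hr.le]
      have h := hglip _ (hmem y hy)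
      rw [add_sub_cancel_left, norm_smul, Real.norm_of_nonneg hr.le] at h
      rw [mem_closedBall_zero_iff] at hy
      have h5 : φ * (r * ‖y‖) ≤ φ * r := by
        have : r * ‖y‖ ≤ r := by nlinarith
        exact mul_le_mul_of_nonneg_left this hφ.le
      nlinarith
  have hcont : Continuous (fun u : sphere (0 : EuclideanSpace ℝ (Fin d)) 1 => f (x + r • (u : EuclideanSpace ℝ (Fin d)))) := by
    refine hflip.continuousOn.comp_continuous (by fun_prop) fun u => hmem _ ?_
    exact sphere_subset_closedBall u.2
  have hint : ∀ {F : Type} [NormedAddCommGroup F] (g : sphere (0 : EuclideanSpace ℝ (Fin d)) 1 → F),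
      Continuous g → Integrable g (volume : Measure (EuclideanSpace ℝ (Fin d))).toSphere :=
    fun g hg => hg.integrable_of_hasCompactSupport (HasCompactSupport.of_compactSpace g)
  have hkc : Continuous (fun u : sphere (0 : EuclideanSpace ℝ (Fin d)) 1 => k u) := by
    exact hcont.sub (by fun_prop)
  set S := ∫ u : sphere (0 : EuclideanSpace ℝ (Fin d)) 1,
          f (x + r • (u : EuclideanSpace ℝ (Fin d))) • (u : EuclideanSpace ℝ (Fin d))
            ∂(volume : Measure (EuclideanSpace ℝ (Fin d))).toSphere with hS
  have hSv : ∀ v, inner ℝ S v = (∫ u : sphere (0 : EuclideanSpace ℝ (Fin d)) 1,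
      k u * inner ℝ (u : EuclideanSpace ℝ (Fin d)) v
        ∂(volume : Measure (EuclideanSpace ℝ (Fin d))).toSphere) + r * (V * inner ℝ w v) := by
    intro v
    rw [← lin_part, ← integral_const_mul, ← integral_add, real_inner_comm, hS, ← integral_inner]
    · congr 1
      ext u
      simp only [hkdef, inner_smul_right]
      rw [real_inner_comm v]
      ring
    · exact hint _ (hcont.smul continuous_subtype_val)
    · exact hint _ (hkc.mul (by fun_prop))
    · exact hint _ (by fun_prop)
  have hU : ∫ u : sphere (0 : EuclideanSpace ℝ (Fin d)) 1,
          f (x + r • (u : EuclideanSpace ℝ (Fin d))) • (u : EuclideanSpace ℝ (Fin d))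
            ∂(unifSphere d) = (d * V)⁻¹ • S := by
    unfold unifSphere
    rw [integral_smul_measure, ENNReal.toReal_inv, ← measureReal_def,
      Measure.toSphere_real_apply_univ, finrank_euclideanSpace_fin]
  rw [hU]
  have hd' : (0 : ℝ) < d := by exact_mod_cast hd
  have hfin : ∀ v, |inner ℝ (((d : ℝ) / r) • (d * V)⁻¹ • S - w) v| ≤ φ * r * ‖v‖ := by
    intro v
    have h := k_part (volume : Measure (EuclideanSpace ℝ (Fin d))) k _ hk v
    have e : inner ℝ (((d : ℝ) / r) • (d * V)⁻¹ • S - w) v =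
      (∫ u : sphere (0 : EuclideanSpace ℝ (Fin d)) 1,
      k u * inner ℝ (u : EuclideanSpace ℝ (Fin d)) v
        ∂(volume : Measure (EuclideanSpace ℝ (Fin d))).toSphere) / (r * V) := by
      rw [inner_sub_left, real_inner_smul_left, real_inner_smul_left, hSv]
      field_simp
      ring
    rw [e, abs_div, abs_of_pos (by positivity : 0 < r * V), div_le_iff₀ (by positivity)]
    refine h.trans (le_of_eq ?_)
    rw [Real.coe_toNNReal _ hM]
    ring
  set z := ((d : ℝ) / r) • (d * V)⁻¹ • S - w
  have h := hfin z
  rw [real_inner_self_eq_norm_sq, abs_of_nonneg (by positivity)] at h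
  by_contra hc
  push Not at hc
  nlinarith [norm_nonneg z, mul_pos hφ hr]
end

section
/- Let 𝒜 ∈ ℝ^{n×n}, ℬ ∈ ℝ^{n×m}, γ ∈ (0,1], Q ∈ ℝ^{n×n} positive semidefinite, R ∈ ℝ^{m×m} positive definite, and Σ ∈ ℝ^{n×n} positive definite. Define 𝕂_s = {K ∈ ℝ^{m×n} : ρ(√γ(𝒜 − ℬK)) < 1} and, for K ∈ 𝕂_s, J(K) = Σ_{t≥0} γᵗ · trace( ((𝒜 − ℬK)ᵗ)ᵀ (Q + KᵀRK) (𝒜 − ℬK)ᵗ Σ ). Then 𝕂_s is an open subset of ℝ^{m×n}, J is differentiable at every K ∈ 𝕂_s, and both J and its gradient ∇J are locally Lipschitz on 𝕂_s: for every K ∈ 𝕂_s there exist positive constants λ_K, ζ_K, φ_K, β_K such that |J(K′) − J(K)| ≤ λ_K ‖K′ − K‖_F whenever ‖K′ − K‖_F ≤ ζ_K, and ‖∇J(K′) − ∇J(K)‖_F ≤ φ_K ‖K′ − K‖_F whenever ‖K′ − K‖_F ≤ β_K. -/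
open Matrix

/-- Reshape a Euclidean vector indexed by `Fin m × Fin n` into an `m × n` matrix.
The Euclidean norm of the vector equals the Frobenius norm of the matrix. -/
def toMat {m n : ℕ} (v : EuclideanSpace ℝ (Fin m × Fin n)) : Matrix (Fin m) (Fin n) ℝ :=
  Matrix.of fun i j => v (i, j)

section aux_general
open Filter Topology
open scoped NNReal ENNReal

theorem aux_decay {A : Type*} [NormedRing A] [NormedAlgebra ℂ A] [CompleteSpace A] (a : A)
    (h : spectralRadius ℂ a < 1) :
    ∃ r : ℝ, 0 ≤ r ∧ r < 1 ∧ ∀ᶠ t : ℕ in atTop, ‖a ^ t‖ ≤ r ^ t := by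
  obtain ⟨r, hr1, hr2⟩ := ENNReal.lt_iff_exists_nnreal_btwn.mp h
  have hlim := spectrum.pow_nnnorm_pow_one_div_tendsto_nhds_spectralRadius a
  refine ⟨r, r.2, by exact_mod_cast hr2, ?_⟩
  filter_upwards [hlim.eventually (gt_mem_nhds hr1), eventually_gt_atTop 0] with t ht ht0
  have ht0' : (0 : ℝ) < t := by exact_mod_cast ht0
  have h2 : ((‖a ^ t‖₊ : ℝ≥0∞) ^ (1 / t : ℝ)) ^ (t : ℝ) ≤ (r : ℝ≥0∞) ^ (t : ℝ) :=
    ENNReal.rpow_le_rpow ht.le ht0'.le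
  rw [← ENNReal.rpow_mul, one_div, inv_mul_cancel₀ ht0'.ne', ENNReal.rpow_one,
    ENNReal.rpow_natCast] at h2
  have h3 : ‖a ^ t‖₊ ≤ r ^ t := by exact_mod_cast h2
  exact_mod_cast h3

theorem aux_open {A : Type*} [NormedRing A] [NormedAlgebra ℂ A] [CompleteSpace A] :
    IsOpen {a : A | spectralRadius ℂ a < 1} := by
  rw [isOpen_iff_mem_nhds]
  intro a ha
  obtain ⟨r, hr0, hr1, hr⟩ := aux_decay a ha
  have hlim : Tendsto (fun t : ℕ => r ^ t * ‖(1 : A)‖) atTop (𝓝 0) := by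
    simpa using (tendsto_pow_atTop_nhds_zero_of_lt_one hr0 hr1).mul_const ‖(1 : A)‖
  have hev := (tendsto_add_atTop_nat 1).eventually (hr.and (hlim.eventually (gt_mem_nhds one_pos)))
  obtain ⟨t, ht1, ht2⟩ := hev.exists
  have ht : ‖a ^ (t + 1)‖ * ‖(1 : A)‖ < 1 :=
    (mul_le_mul_of_nonneg_right ht1 (norm_nonneg _)).trans_lt ht2
  have hc : Continuous (fun b : A => ‖b ^ (t + 1)‖ * ‖(1 : A)‖) := by fun_prop
  filter_upwards [hc.continuousAt.eventually (gt_mem_nhds ht)] with b hb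
  refine (spectrum.spectralRadius_le_pow_nnnorm_pow_one_div ℂ b t).trans_lt ?_
  have hp : (0 : ℝ) < 1 / (t + 1) := by positivity
  rw [← ENNReal.mul_rpow_of_nonneg _ _ hp.le]
  refine ENNReal.rpow_lt_one ?_ hp
  have : ‖b ^ (t + 1)‖₊ * ‖(1 : A)‖₊ < 1 := by exact_mod_cast hb
  exact_mod_cast this

theorem aux_inverse {A : Type*} [NormedRing A] [CompleteSpace A] (x : A)
    (h : Summable fun t : ℕ => x ^ t) :
    ∃ u : Aˣ, (u : A) = 1 - x ∧ Ring.inverse (1 - x) = ∑' t : ℕ, x ^ t := by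
  have h1 : (1 - x) * ∑' t : ℕ, x ^ t = 1 := h.one_sub_mul_tsum_pow
  have h2 : (∑' t : ℕ, x ^ t) * (1 - x) = 1 := h.tsum_pow_mul_one_sub
  let u : Aˣ := ⟨1 - x, _, h1, h2⟩
  exact ⟨u, rfl, Ring.inverse_unit u⟩

theorem aux_key {E F : Type*} [NormedAddCommGroup E] [NormedSpace ℝ E]
    [NormedAddCommGroup F] [NormedSpace ℝ F] (v : E) (f : E → F) (hf : ContDiffAt ℝ 1 f v) :
    ∃ l z : ℝ, 0 < l ∧ 0 < z ∧ ∀ v', ‖v' - v‖ ≤ z → ‖f v' - f v‖ ≤ l * ‖v' - v‖ := by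
  obtain ⟨K, t, ht, hK⟩ := hf.exists_lipschitzOnWith
  obtain ⟨z, hz, hzt⟩ := Metric.nhds_basis_closedBall.mem_iff.mp ht
  refine ⟨K + 1, z, by positivity, hz, fun v' hv' => ?_⟩
  have h1 : v' ∈ t := hzt (by simpa [dist_eq_norm] using hv')
  have h2 := hK.dist_le_mul v' h1 v (mem_of_mem_nhds ht)
  rw [dist_eq_norm, dist_eq_norm] at h2
  nlinarith [norm_nonneg (v' - v)]

theorem aux_final {E : Type*} [NormedAddCommGroup E] [InnerProductSpace ℝ E] [CompleteSpace E]
    (J : E → ℝ) (v : E) (h : ContDiffAt ℝ 2 J v) :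
    ∃ lam ζ φ β : ℝ, 0 < lam ∧ 0 < ζ ∧ 0 < φ ∧ 0 < β ∧
      (∀ v', ‖v' - v‖ ≤ ζ → |J v' - J v| ≤ lam * ‖v' - v‖) ∧
      (∀ v', ‖v' - v‖ ≤ β → ‖gradient J v' - gradient J v‖ ≤ φ * ‖v' - v‖) := by
  obtain ⟨l, z, hl, hz, H1⟩ := aux_key v J (h.of_le (by norm_num))
  have hfd : ContDiffAt ℝ 1 (fderiv ℝ J) v := h.fderiv_right (by norm_num)
  obtain ⟨l', z', hl', hz', H2⟩ := aux_key v (gradient J)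
    ((InnerProductSpace.toDual ℝ E).symm.contDiff.contDiffAt.comp v hfd)
  exact ⟨l, z, l', z', hl, hz, hl', hz', H1, H2⟩

end aux_general

section aux_matrix
open Filter Topology
open scoped Matrix.Norms.Frobenius

/-- linear version of the reshaping -/
def toMatL (m n : ℕ) : EuclideanSpace ℝ (Fin m × Fin n) →ₗ[ℝ] Matrix (Fin m) (Fin n) ℝ where
  toFun := toMat
  map_add' := fun _ _ => rfl
  map_smul' := fun _ _ => rfl

theorem aux_contDiff_lin {E F : Type*} [NormedAddCommGroup E] [NormedSpace ℝ E]
    [FiniteDimensional ℝ E] [NormedAddCommGroup F] [NormedSpace ℝ F] (f : E →ₗ[ℝ] F)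
    (k : WithTop ℕ∞) : ContDiff ℝ k (f : E → F) :=
  (LinearMap.toContinuousLinearMap f).contDiff

theorem aux_F {n m : ℕ} (A : Matrix (Fin n) (Fin n) ℝ) (B : Matrix (Fin n) (Fin m) ℝ) (s : ℝ) :
    ContDiff ℝ 2 (fun v : EuclideanSpace ℝ (Fin m × Fin n) => s • (A - B * toMat v)) := by
  let f : EuclideanSpace ℝ (Fin m × Fin n) →ₗ[ℝ] Matrix (Fin n) (Fin n) ℝ :=
    { toFun := fun v => B * toMat v
      map_add' := fun x y => by
        show B * toMatL m n (x + y) = _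
        rw [map_add, Matrix.mul_add]; rfl
      map_smul' := fun c x => by
        show B * toMatL m n (c • x) = _
        rw [map_smul, Matrix.mul_smul]; rfl }
  exact (contDiff_const.sub (aux_contDiff_lin f 2)).const_smul s

theorem aux_isOpen {n m : ℕ} (A : Matrix (Fin n) (Fin n) ℝ) (B : Matrix (Fin n) (Fin m) ℝ)
    (s : ℝ) :
    IsOpen {v : EuclideanSpace ℝ (Fin m × Fin n) | spectralRadius ℂ
      ((s • (A - B * toMat v)).map (Complex.ofReal : ℝ → ℂ)) < 1} := by
  have h1 : Continuous (fun v : EuclideanSpace ℝ (Fin m × Fin n) =>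
      (s • (A - B * toMat v)).map (Complex.ofReal : ℝ → ℂ)) :=
    (aux_F A B s).continuous.matrix_map Complex.continuous_ofReal
  exact (aux_open (A := Matrix (Fin n) (Fin n) ℂ)).preimage h1

theorem aux_summable {n : ℕ} (M : Matrix (Fin n) (Fin n) ℝ)
    (h : spectralRadius ℂ (M.map (Complex.ofReal : ℝ → ℂ)) < 1) :
    Summable fun t : ℕ =>
      (ContinuousLinearMap.mulLeftRight ℝ (Matrix (Fin n) (Fin n) ℝ) M Mᵀ) ^ t := by
  obtain ⟨r, hr0, hr1, hr⟩ := aux_decay (M.map (Complex.ofReal : ℝ → ℂ)) h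
  have hpow : ∀ t : ℕ, (ContinuousLinearMap.mulLeftRight ℝ (Matrix (Fin n) (Fin n) ℝ) M Mᵀ) ^ t
      = ContinuousLinearMap.mulLeftRight ℝ (Matrix (Fin n) (Fin n) ℝ) (M ^ t) (M ^ t)ᵀ := by
    intro t
    induction t with
    | zero => ext1 X; simp
    | succ k ih =>
      rw [pow_succ', ih]
      ext1 X
      simp only [mul_apply_eq_comp, ContinuousLinearMap.mulLeftRight_apply]
      rw [pow_succ', Matrix.transpose_mul]
      simp only [Matrix.mul_assoc]
  refine Summable.of_norm_bounded_eventually_nat (summable_geometric_of_lt_one hr0 hr1) ?_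
  filter_upwards [hr] with t ht
  rw [hpow]
  have e : (M.map (Complex.ofReal : ℝ → ℂ)) ^ t = (M ^ t).map (Complex.ofReal : ℝ → ℂ) :=
    (map_pow (Complex.ofRealHom.mapMatrix (m := Fin n)) M t).symm
  rw [e, Matrix.frobenius_norm_map_eq _ _ (fun a => Complex.norm_real a)] at ht
  refine (ContinuousLinearMap.opNorm_mulLeftRight_apply_apply_le ℝ _ _ _).trans ?_
  rw [Matrix.frobenius_norm_transpose]
  have h1 : r ^ t ≤ 1 := pow_le_one₀ hr0 hr1.le
  have := norm_nonneg (M ^ t)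
  nlinarith

theorem aux_pow {n : ℕ} (M : Matrix (Fin n) (Fin n) ℝ) (t : ℕ) :
    (ContinuousLinearMap.mulLeftRight ℝ (Matrix (Fin n) (Fin n) ℝ) M Mᵀ) ^ t
      = ContinuousLinearMap.mulLeftRight ℝ (Matrix (Fin n) (Fin n) ℝ) (M ^ t) (M ^ t)ᵀ := by
  induction t with
  | zero => ext1 X; simp
  | succ k ih =>
    rw [pow_succ', ih]
    ext1 X
    simp only [mul_apply_eq_comp, ContinuousLinearMap.mulLeftRight_apply]
    rw [pow_succ', Matrix.transpose_mul]
    simp only [Matrix.mul_assoc]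

theorem aux_formula {n : ℕ} (γ : ℝ) (hγ0 : 0 < γ) (F W Sig : Matrix (Fin n) (Fin n) ℝ)
    (h : spectralRadius ℂ ((Real.sqrt γ • F).map (Complex.ofReal : ℝ → ℂ)) < 1) :
    ∑' t : ℕ, γ ^ t * (((F ^ t)ᵀ * W * (F ^ t)) * Sig).trace =
      (W * (Ring.inverse (1 - ContinuousLinearMap.mulLeftRight ℝ (Matrix (Fin n) (Fin n) ℝ)
        (Real.sqrt γ • F) (Real.sqrt γ • F)ᵀ) Sig)).trace := by
  have hs := aux_summable _ h
  obtain ⟨u, -, hu⟩ := aux_inverse _ hs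
  rw [hu]
  let g : (Matrix (Fin n) (Fin n) ℝ →L[ℝ] Matrix (Fin n) (Fin n) ℝ) →ₗ[ℝ] ℝ :=
    { toFun := fun T => (W * T Sig).trace
      map_add' := fun x y => by simp [Matrix.mul_add]
      map_smul' := fun c x => by simp }
  have := (LinearMap.toContinuousLinearMap g).map_tsum hs
  refine Eq.trans ?_ this.symm
  refine tsum_congr fun t => ?_
  rw [aux_pow]
  show _ = (W * ((Real.sqrt γ • F) ^ t * Sig * ((Real.sqrt γ • F) ^ t)ᵀ)).trace
  have h2 : Real.sqrt γ ^ t * Real.sqrt γ ^ t = γ ^ t := by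
    rw [← mul_pow, Real.mul_self_sqrt hγ0.le]
  rw [smul_pow, Matrix.transpose_smul]
  simp only [Matrix.smul_mul, Matrix.mul_smul, smul_smul, Matrix.trace_smul, h2, smul_eq_mul]
  congr 1
  rw [Matrix.mul_assoc, Matrix.mul_assoc, Matrix.trace_mul_comm]
  simp only [Matrix.mul_assoc]

theorem aux_contDiffAt {n m : ℕ} (A : Matrix (Fin n) (Fin n) ℝ) (B : Matrix (Fin n) (Fin m) ℝ)
    (γ : ℝ) (hγ0 : 0 < γ)
    (Q : Matrix (Fin n) (Fin n) ℝ) (R : Matrix (Fin m) (Fin m) ℝ)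
    (Sig : Matrix (Fin n) (Fin n) ℝ)
    (J : EuclideanSpace ℝ (Fin m × Fin n) → ℝ)
    (hJ : ∀ v, J v = ∑' t : ℕ, γ ^ t *
      ((((A - B * toMat v) ^ t)ᵀ * (Q + (toMat v)ᵀ * R * toMat v) *
        ((A - B * toMat v) ^ t)) * Sig).trace)
    (v : EuclideanSpace ℝ (Fin m × Fin n))
    (hv : spectralRadius ℂ
      ((Real.sqrt γ • (A - B * toMat v)).map (Complex.ofReal : ℝ → ℂ)) < 1) :
    ContDiffAt ℝ 2 J v := by
  let L := fun w : EuclideanSpace ℝ (Fin m × Fin n) =>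
    ContinuousLinearMap.mulLeftRight ℝ (Matrix (Fin n) (Fin n) ℝ)
        (Real.sqrt γ • (A - B * toMat w)) (Real.sqrt γ • (A - B * toMat w))ᵀ
  let X := fun w => Ring.inverse (1 - L w) Sig
  have hEq : J =ᶠ[𝓝 v] fun w => ((Q + (toMat w)ᵀ * R * toMat w) * X w).trace := by
    filter_upwards [(aux_isOpen A B (Real.sqrt γ)).mem_nhds hv] with w hw
    rw [hJ, aux_formula γ hγ0 _ _ _ hw]
  refine ContDiffAt.congr_of_eventuallyEq ?_ hEq
  have hF := aux_F A B (Real.sqrt γ)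
  have hFt : ContDiff ℝ 2 (fun w : EuclideanSpace ℝ (Fin m × Fin n) =>
      (Real.sqrt γ • (A - B * toMat w))ᵀ) :=
    (aux_contDiff_lin (Matrix.transposeLinearEquiv (Fin n) (Fin n) ℝ ℝ).toLinearMap 2).comp hF
  have hL : ContDiff ℝ 2 L :=
    ((ContinuousLinearMap.contDiff _).comp hF).clm_apply hFt
  obtain ⟨u, hu, -⟩ := aux_inverse _ (aux_summable _ hv)
  have hinv : ContDiffAt ℝ 2 (fun w => Ring.inverse (1 - L w)) v := by
    have h1 : ContDiffAt ℝ 2 Ring.inverse (1 - L v) := by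
      have := contDiffAt_ringInverse (n := 2) ℝ u
      rwa [hu] at this
    exact ContDiffAt.comp v h1 (contDiff_const.sub hL).contDiffAt
  have hX : ContDiffAt ℝ 2 X v := hinv.clm_apply contDiffAt_const
  have hXe : ∀ i j, ContDiffAt ℝ 2 (fun w => X w i j) v := fun i j =>
    (aux_contDiff_lin (Matrix.entryLinearMap ℝ ℝ i j) 2).contDiffAt.comp v hX
  have hKe : ∀ i j, ContDiffAt ℝ 2 (fun w : EuclideanSpace ℝ (Fin m × Fin n) => toMat w i j) v :=
    fun i j => (aux_contDiff_lin ((Matrix.entryLinearMap ℝ ℝ i j).comp (toMatL m n)) 2).contDiffAt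
  simp only [Matrix.trace, Matrix.diag, Matrix.mul_apply, Matrix.add_apply, Matrix.transpose_apply]
  refine ContDiffAt.sum fun i _ => ContDiffAt.sum fun j _ => ContDiffAt.mul ?_ (hXe j i)
  refine contDiffAt_const.add (ContDiffAt.sum fun k _ => ContDiffAt.mul ?_ (hKe k j))
  exact ContDiffAt.sum fun l _ => (hKe l i).mul contDiffAt_const

end aux_matrix

/-- smoothness of the discounted LQR cost, Lemma 4(ii).
With the control gain identified with its vectorization (so that the Euclidean norm is
the Frobenius norm), the Schur-stabilizing set `𝕂_s = {K : ρ(√γ(𝒜−ℬK)) < 1}` is open,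
the LQR cost `J(K) = Σ_{t≥0} γᵗ trace(((𝒜−ℬK)ᵗ)ᵀ (Q + KᵀRK) (𝒜−ℬK)ᵗ Σ)` is
differentiable on `𝕂_s`, and both `J` and its gradient `∇J` are locally Lipschitz on
`𝕂_s`. -/
theorem stmt_15 {n m : ℕ} (A : Matrix (Fin n) (Fin n) ℝ) (B : Matrix (Fin n) (Fin m) ℝ)
    (γ : ℝ) (hγ0 : 0 < γ) (hγ1 : γ ≤ 1)
    (Q : Matrix (Fin n) (Fin n) ℝ) (hQ : Q.PosSemidef)
    (R : Matrix (Fin m) (Fin m) ℝ) (hR : R.PosDef)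
    (Sig : Matrix (Fin n) (Fin n) ℝ) (hSig : Sig.PosDef)
    (Ks : Set (EuclideanSpace ℝ (Fin m × Fin n)))
    (hKs : Ks = {v | spectralRadius ℂ
      ((Real.sqrt γ • (A - B * toMat v)).map (Complex.ofReal : ℝ → ℂ)) < 1})
    (J : EuclideanSpace ℝ (Fin m × Fin n) → ℝ)
    (hJ : ∀ v, J v = ∑' t : ℕ, γ ^ t *
      ((((A - B * toMat v) ^ t)ᵀ * (Q + (toMat v)ᵀ * R * toMat v) *
        ((A - B * toMat v) ^ t)) * Sig).trace) :
    IsOpen Ks ∧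
    (∀ v ∈ Ks, DifferentiableAt ℝ J v) ∧
    (∀ v ∈ Ks, ∃ lam ζ φ β : ℝ, 0 < lam ∧ 0 < ζ ∧ 0 < φ ∧ 0 < β ∧
      (∀ v', ‖v' - v‖ ≤ ζ → |J v' - J v| ≤ lam * ‖v' - v‖) ∧
      (∀ v', ‖v' - v‖ ≤ β → ‖gradient J v' - gradient J v‖ ≤ φ * ‖v' - v‖)) := by
  have hC : ∀ v ∈ Ks, ContDiffAt ℝ 2 J v := by
    intro v hv
    rw [hKs] at hv
    exact aux_contDiffAt A B γ hγ0 Q R Sig J hJ v hv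
  refine ⟨?_, fun v hv => (hC v hv).differentiableAt (by norm_num),
    fun v hv => aux_final J v (hC v hv)⟩
  rw [hKs]
  exact aux_isOpen A B (Real.sqrt γ)
end

section
/- Let f : ℝ^d → ℝ be Lipschitz continuous on the ball {y : ‖y − x‖ ≤ β}, differentiable there, with ‖∇f(y) − ∇f(x)‖ ≤ φ‖y − x‖ for all y with ‖y − x‖ ≤ β, where φ, β > 0. Let 0 < r ≤ β and ε′ ≥ 0, and let f̃ : ℝ^d → ℝ be a measurable function with |f̃(x + r u) − f(x + r u)| ≤ ε′ for every u ∈ 𝕊_{d−1}. Then ‖ (d/r) · E_{u∼Uni(𝕊_{d−1})}[f̃(x + r u) u] − ∇f(x) ‖ ≤ (d/r)·ε′ + φ r. -/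
open MeasureTheory Metric

abbrev EE (d : ℕ) := EuclideanSpace ℝ (Fin d)

/-- action of a linear isometry on the sphere -/
noncomputable def sphMap {d : ℕ} (T : EE d ≃ₗᵢ[ℝ] EE d) (u : sphere (0 : EE d) 1) : sphere (0 : EE d) 1 :=
  ⟨T u, by simp⟩

lemma sphMap_cont {d : ℕ} (T : EE d ≃ₗᵢ[ℝ] EE d) : Continuous (sphMap T) := by
  unfold sphMap
  exact Continuous.subtype_mk (T.continuous.comp continuous_subtype_val) _

lemma sphMap_mp0 {d : ℕ} (T : EE d ≃ₗᵢ[ℝ] EE d) :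
    MeasurePreserving (sphMap T) (volume : Measure (EE d)).toSphere
      (volume : Measure (EE d)).toSphere := by
  refine ⟨(sphMap_cont T).measurable, ?_⟩
  ext s hs
  rw [Measure.map_apply (sphMap_cont T).measurable hs, Measure.toSphere_apply' _ hs,
    Measure.toSphere_apply' _ ((sphMap_cont T).measurable hs)]
  congr 1
  conv_rhs => rw [← MeasurePreserving.measure_preimage_equiv (f := T.toMeasurableEquiv) T.measurePreserving]
  congr 1
  ext y
  simp only [Set.mem_smul, Set.mem_image, Set.mem_preimage]
  constructor
  · rintro ⟨a, ha, _, ⟨u, hu, rfl⟩, rfl⟩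
    exact ⟨a, ha, _, ⟨_, hu, rfl⟩, by simp [sphMap]⟩
  · rintro ⟨a, ha, _, ⟨u, hu, rfl⟩, h⟩
    refine ⟨a, ha, _, ⟨sphMap T.symm u, ?_, rfl⟩, ?_⟩
    · have : sphMap T (sphMap T.symm u) = u := by
        ext1; simp [sphMap]
      simpa [this] using hu
    · apply T.injective
      simpa [sphMap] using h

lemma sphMap_mp {d : ℕ} (T : EE d ≃ₗᵢ[ℝ] EE d) :
    MeasurePreserving (sphMap T) (unifSphere d) (unifSphere d) :=
  (sphMap_mp0 T).smul_measure _

lemma unif_prob {d : ℕ} (hd : d ≠ 0) : IsProbabilityMeasure (unifSphere d) := by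
  have : Nonempty (Fin d) := ⟨⟨0, Nat.pos_of_ne_zero hd⟩⟩
  constructor
  unfold unifSphere
  rw [Measure.smul_apply, smul_eq_mul]
  apply ENNReal.inv_mul_cancel
  · have := Measure.toSphere_ne_zero (volume : Measure (EE d))
    exact fun h => this (Measure.measure_univ_eq_zero.1 h)
  · exact measure_ne_top _ _

lemma sph_integral {d : ℕ} (T : EE d ≃ₗᵢ[ℝ] EE d) (g : sphere (0 : EE d) 1 → ℝ)
    (hg : Continuous g) :
    ∫ u, g (sphMap T u) ∂(unifSphere d) = ∫ u, g u ∂(unifSphere d) := by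
  have h := (sphMap_mp T).map_eq
  conv_rhs => rw [← h]
  rw [integral_map (sphMap_cont T).measurable.aemeasurable]
  exact hg.measurable.aestronglyMeasurable

lemma cont_integrable {d : ℕ} (hd : d ≠ 0) (g : sphere (0 : EE d) 1 → ℝ) (hg : Continuous g) :
    Integrable g (unifSphere d) := by
  have := unif_prob hd
  exact hg.integrable_of_hasCompactSupport (HasCompactSupport.of_compactSpace g)

lemma second_moment {d : ℕ} (hd : d ≠ 0) (v : EE d) (hv : ‖v‖ = 1) :
    ∫ u, (inner ℝ (u : EE d) v) ^ 2 ∂(unifSphere d) = 1 / d := by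
  have := unif_prob hd
  have key : ∀ w : EE d, ‖w‖ = 1 → ∫ u, (inner ℝ (u : EE d) w) ^ 2 ∂(unifSphere d)
      = ∫ u, (inner ℝ (u : EE d) v) ^ 2 ∂(unifSphere d) := by
    intro w hw
    set T : EE d ≃ₗᵢ[ℝ] EE d := Submodule.reflection (Submodule.span ℝ {v - w})ᗮ
    have hT : T v = w := Submodule.reflection_sub (by rw [hv, hw])
    rw [← sph_integral T _ (by fun_prop)]
    congr 1; ext u
    rw [← hT]
    simp [sphMap, T.inner_map_map]
  have hsum : ∑ i : Fin d, ∫ u, (inner ℝ (u : EE d) (EuclideanSpace.basisFun (Fin d) ℝ i)) ^ 2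
      ∂(unifSphere d) = 1 := by
    rw [← integral_finsetSum _ (fun i _ => cont_integrable hd _ (by fun_prop))]
    have : ∀ u : sphere (0 : EE d) 1,
        ∑ i : Fin d, (inner ℝ (u : EE d) (EuclideanSpace.basisFun (Fin d) ℝ i)) ^ 2 = 1 := by
      intro u
      have := (EuclideanSpace.basisFun (Fin d) ℝ).sum_sq_inner_left (u : EE d)
      simp at this
      simpa using this
    simp only [this]
    simp
  simp_rw [fun i => key (EuclideanSpace.basisFun (Fin d) ℝ i) (by simp)] at hsum
  simp at hsum
  field_simp
  linarith

lemma remainder {d : ℕ} (f : EE d → ℝ) (x : EE d) (φ β : ℝ) (hφ : 0 < φ)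
    (hdiff : ∀ y ∈ closedBall x β, DifferentiableAt ℝ f y)
    (hglip : ∀ y ∈ closedBall x β, ‖gradient f y - gradient f x‖ ≤ φ * ‖y - x‖)
    (r : ℝ) (hrβ : r ≤ β) (y z : EE d) (hy : y ∈ closedBall x r) (hz : z ∈ closedBall x r) :
    |f y - f z - inner ℝ (gradient f x) (y - z)| ≤ φ * r * ‖y - z‖ := by
  have hsub := closedBall_subset_closedBall (x := x) hrβ
  have := (convex_closedBall x r).norm_image_sub_le_of_norm_hasFDerivWithin_le' (𝕜 := ℝ)
    (f := f) (f' := fun y => fderiv ℝ f y) (φ := fderiv ℝ f x) (C := φ * r)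
    (fun y hy => (hdiff y (hsub hy)).hasFDerivAt.hasFDerivWithinAt)
    (fun y hy => ?_) hz hy
  · have h2 : fderiv ℝ f x (y - z) = inner ℝ (gradient f x) (y - z) := by
      simp [gradient]
    rwa [h2, Real.norm_eq_abs] at this
  · have := hglip y (hsub hy)
    rw [gradient, gradient, ← map_sub, LinearIsometryEquiv.norm_map] at this
    refine this.trans ?_
    gcongr
    simpa [dist_eq_norm] using hy

lemma smooth_part {d : ℕ} (hd : d ≠ 0) (f : EE d → ℝ) (x : EE d) (φ β : ℝ) (hφ : 0 < φ)
    (hdiff : ∀ y ∈ closedBall x β, DifferentiableAt ℝ f y)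
    (hglip : ∀ y ∈ closedBall x β, ‖gradient f y - gradient f x‖ ≤ φ * ‖y - x‖)
    (r : ℝ) (hr : 0 < r) (hrβ : r ≤ β) (v : EE d) (hv : ‖v‖ = 1)
    (hfc : Continuous (fun u : sphere (0 : EE d) 1 => f (x + r • (u : EE d)))) :
    |∫ u : sphere (0 : EE d) 1, f (x + r • (u : EE d)) * inner ℝ (u : EE d) v ∂(unifSphere d)
      - r * inner ℝ (gradient f x) v / d| ≤ φ * r ^ 2 / d := by
  have := unif_prob hd
  set T : EE d ≃ₗᵢ[ℝ] EE d := Submodule.reflection (Submodule.span ℝ {v})ᗮ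
  have hT : ∀ u : EE d, T u = u - (2 * inner ℝ u v) • v := by
    intro u
    have := Submodule.reflection_orthogonal_apply (K := Submodule.span ℝ {v}) u
    rw [this, Submodule.reflection_singleton_apply, hv, real_inner_comm]
    simp [two_mul, two_smul, add_smul]
  have hTv : ∀ u : EE d, inner ℝ (T u) v = - inner ℝ u v := by
    intro u
    rw [hT, inner_sub_left, inner_smul_left, real_inner_self_eq_norm_sq, hv]
    simp; ring
  have c1 : Continuous (fun u : sphere (0 : EE d) 1 =>
      f (x + r • (u : EE d)) * inner ℝ (u : EE d) v) := hfc.mul (by fun_prop)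
  have c2 : Continuous (fun u : sphere (0 : EE d) 1 =>
      f (x + r • (T u : EE d)) * inner ℝ (u : EE d) v) :=
    (hfc.comp (sphMap_cont T)).mul (by fun_prop)
  have e1 : ∫ u : sphere (0 : EE d) 1, f (x + r • (u : EE d)) * inner ℝ (u : EE d) v
      ∂(unifSphere d) = - ∫ u : sphere (0 : EE d) 1, f (x + r • (T u : EE d)) *
        inner ℝ (u : EE d) v ∂(unifSphere d) := by
    rw [← sph_integral T _ c1, ← integral_neg]
    congr 1; ext u
    simp only [sphMap, hTv]; ring
  set I := ∫ u : sphere (0 : EE d) 1, f (x + r • (u : EE d)) * inner ℝ (u : EE d) v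
      ∂(unifSphere d)
  have e2 : 2 * (I - r * inner ℝ (gradient f x) v / d) = ∫ u : sphere (0 : EE d) 1,
      (f (x + r • (u : EE d)) * inner ℝ (u : EE d) v - f (x + r • (T u : EE d)) *
        inner ℝ (u : EE d) v - (2 * r * inner ℝ (gradient f x) v) * inner ℝ (u : EE d) v ^ 2)
        ∂(unifSphere d) := by
    rw [integral_sub (f := fun u : sphere (0 : EE d) 1 =>
        f (x + r • (u : EE d)) * inner ℝ (u : EE d) v - f (x + r • (T u : EE d)) *
        inner ℝ (u : EE d) v) (cont_integrable hd _ (c1.sub c2))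
      (cont_integrable hd _ (by fun_prop)),
      integral_sub (cont_integrable hd _ c1) (cont_integrable hd _ c2),
      integral_const_mul, second_moment hd v hv]
    linear_combination e1
  have e3 : |2 * (I - r * inner ℝ (gradient f x) v / d)| ≤ ∫ u : sphere (0 : EE d) 1,
      (2 * φ * r ^ 2) * inner ℝ (u : EE d) v ^ 2 ∂(unifSphere d) := by
    rw [e2, ← Real.norm_eq_abs]
    refine norm_integral_le_of_norm_le (cont_integrable hd _ (by fun_prop)) (.of_forall ?_)
    intro u
    have hu : ‖(u : EE d)‖ = 1 := by simp
    have := remainder f x φ β hφ hdiff hglip r hrβ (x + r • (u : EE d)) (x + r • (T u : EE d))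
      (by simp [norm_smul, abs_of_pos hr]) (by simp [norm_smul, abs_of_pos hr])
    have hs : (x + r • (u : EE d)) - (x + r • (T u : EE d))
        = (2 * r * inner ℝ (u : EE d) v) • v := by
      rw [hT]; module
    rw [hs, inner_smul_right, norm_smul, hv, Real.norm_eq_abs, abs_mul (2 * r),
      abs_of_pos (show 0 < 2 * r by positivity)] at this
    rw [Real.norm_eq_abs]
    calc _ = |f (x + r • (u : EE d)) - f (x + r • (T u : EE d)) -
          2 * r * inner ℝ (u : EE d) v * inner ℝ (gradient f x) v| * |inner ℝ (u : EE d) v| := by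
          rw [← abs_mul]; congr 1; ring
      _ ≤ (φ * r * (2 * r * |inner ℝ (u : EE d) v| * 1)) * |inner ℝ (u : EE d) v| := by
          gcongr
      _ = _ := by
          rw [← sq_abs (inner ℝ (u : EE d) v)]; ring
  rw [integral_const_mul, second_moment hd v hv, abs_mul, abs_two] at e3
  have : 2 * φ * r ^ 2 * (1 / (d : ℝ)) = 2 * (φ * r ^ 2 / d) := by ring
  linarith

/-- gradient-estimate bias bound (40) of Lemma 6: truncation error
plus smoothing bias. If `f` is Lipschitz and differentiable on the ball of radius `β`
around `x` with `‖∇f(y) − ∇f(x)‖ ≤ φ‖y − x‖` there, `0 < r ≤ β`, and `f̃` is a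
measurable function with `|f̃(x + r u) − f(x + r u)| ≤ ε′` for every unit vector `u`,
then `‖(d/r) 𝔼_{u∼Uni(𝕊_{d−1})}[f̃(x + r u) u] − ∇f(x)‖ ≤ (d/r) ε′ + φ r`. -/
theorem stmt_17 {d : ℕ} (f : EuclideanSpace ℝ (Fin d) → ℝ)
    (x : EuclideanSpace ℝ (Fin d)) (φ β : ℝ) (hφ : 0 < φ) (hβ : 0 < β)
    (L : NNReal) (hflip : LipschitzOnWith L f (closedBall x β))
    (hdiff : ∀ y ∈ closedBall x β, DifferentiableAt ℝ f y)
    (hglip : ∀ y ∈ closedBall x β, ‖gradient f y - gradient f x‖ ≤ φ * ‖y - x‖)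
    (r : ℝ) (hr : 0 < r) (hrβ : r ≤ β)
    (ε' : ℝ) (hε' : 0 ≤ ε') (ftilde : EuclideanSpace ℝ (Fin d) → ℝ)
    (hmeas : Measurable ftilde)
    (happrox : ∀ u : EuclideanSpace ℝ (Fin d), ‖u‖ = 1 →
      |ftilde (x + r • u) - f (x + r • u)| ≤ ε') :
    ‖(((d : ℝ) / r) •
        ∫ u : sphere (0 : EuclideanSpace ℝ (Fin d)) 1,
          ftilde (x + r • (u : EuclideanSpace ℝ (Fin d))) • (u : EuclideanSpace ℝ (Fin d))
            ∂(unifSphere d)) - gradient f x‖ ≤ ((d : ℝ) / r) * ε' + φ * r := by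
  have hrhs : 0 ≤ ((d : ℝ) / r) * ε' + φ * r := by positivity
  rcases eq_or_ne d 0 with hd | hd
  · subst hd
    rw [Subsingleton.elim (_ - gradient f x) 0, norm_zero]
    exact hrhs
  have := unif_prob hd
  have hd' : (0 : ℝ) < d := by exact_mod_cast Nat.pos_of_ne_zero hd
  have hfc : Continuous (fun u : sphere (0 : EE d) 1 => f (x + r • (u : EE d))) := by
    refine hflip.continuousOn.comp_continuous (by fun_prop) (fun u => ?_)
    simpa [norm_smul, abs_of_pos hr] using hrβ
  have hmt : Measurable (fun u : sphere (0 : EE d) 1 => ftilde (x + r • (u : EE d))) :=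
    hmeas.comp (by fun_prop)
  have hdi : Integrable (fun u : sphere (0 : EE d) 1 =>
      ftilde (x + r • (u : EE d)) - f (x + r • (u : EE d))) (unifSphere d) := by
    refine Integrable.of_bound (C := ε') (hmt.sub hfc.measurable).aestronglyMeasurable
      (.of_forall fun u => ?_)
    exact happrox u (by simp)
  have hti : Integrable (fun u : sphere (0 : EE d) 1 => ftilde (x + r • (u : EE d)))
      (unifSphere d) := by
    refine (hdi.add (cont_integrable hd _ hfc)).congr (.of_forall fun u => ?_)
    simp
  have hvi : Integrable (fun u : sphere (0 : EE d) 1 =>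
      ftilde (x + r • (u : EE d)) • (u : EE d)) (unifSphere d) := by
    refine hti.norm.mono' ?_ (.of_forall fun u => ?_)
    · exact (hmt.smul measurable_subtype_coe).aestronglyMeasurable
    · simp [norm_smul]
  set w := (((d : ℝ) / r) •
        ∫ u : sphere (0 : EuclideanSpace ℝ (Fin d)) 1,
          ftilde (x + r • (u : EuclideanSpace ℝ (Fin d))) • (u : EuclideanSpace ℝ (Fin d))
            ∂(unifSphere d)) - gradient f x with hw
  rcases eq_or_ne w 0 with h0 | h0
  · rw [h0, norm_zero]; exact hrhs
  set v := ‖w‖⁻¹ • w with hvdef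
  have hwn : ‖w‖ ≠ 0 := norm_ne_zero_iff.2 h0
  have hv : ‖v‖ = 1 := by
    rw [hvdef, norm_smul, norm_inv, norm_norm, inv_mul_cancel₀ hwn]
  have hwv : inner ℝ v w = ‖w‖ := by
    rw [hvdef, real_inner_smul_left, real_inner_self_eq_norm_sq]
    field_simp
  have hb : ∀ u : sphere (0 : EE d) 1, |inner ℝ (u : EE d) v| ≤ 1 := by
    intro u
    simpa [hv] using abs_real_inner_le_norm (u : EE d) v
  have hS := smooth_part hd f x φ β hφ hdiff hglip r hr hrβ v hv hfc
  have c1 : Continuous (fun u : sphere (0 : EE d) 1 =>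
      f (x + r • (u : EE d)) * inner ℝ (u : EE d) v) := hfc.mul (by fun_prop)
  have hD : |∫ u : sphere (0 : EE d) 1, (ftilde (x + r • (u : EE d)) - f (x + r • (u : EE d))) *
      inner ℝ (u : EE d) v ∂(unifSphere d)| ≤ ε' := by
    have := norm_integral_le_of_norm_le_const (μ := unifSphere d) (C := ε')
      (f := fun u : sphere (0 : EE d) 1 =>
        (ftilde (x + r • (u : EE d)) - f (x + r • (u : EE d))) * inner ℝ (u : EE d) v)
      (.of_forall fun u => by
        rw [Real.norm_eq_abs, abs_mul]
        have := mul_le_mul (happrox u (by simp)) (hb u) (abs_nonneg _) hε'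
        simpa using this)
    simpa using this
  have hvi2 : Integrable (fun u : sphere (0 : EE d) 1 =>
      ftilde (x + r • (u : EE d)) * inner ℝ (u : EE d) v) (unifSphere d) := by
    have := hvi.const_inner (𝕜 := ℝ) v
    refine this.congr (.of_forall fun u => ?_)
    simp only [real_inner_smul_right, real_inner_comm v]
  have hsplit : inner ℝ v w = (d / r) * ((∫ u : sphere (0 : EE d) 1,
      (ftilde (x + r • (u : EE d)) - f (x + r • (u : EE d))) *
      inner ℝ (u : EE d) v ∂(unifSphere d)) +
      ((∫ u : sphere (0 : EE d) 1, f (x + r • (u : EE d)) * inner ℝ (u : EE d) v ∂(unifSphere d))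
      - r * inner ℝ (gradient f x) v / d)) := by
    simp_rw [sub_mul]
    rw [integral_sub hvi2 (cont_integrable hd _ c1), hw, inner_sub_right, real_inner_smul_right,
      ← integral_inner hvi]
    simp_rw [real_inner_smul_right, real_inner_comm v]
    field_simp
    ring
  rw [← hwv, hsplit]
  calc _ ≤ (d / r) * (ε' + φ * r ^ 2 / d) := by
        gcongr
        · exact (le_abs_self _).trans hD
        · exact (le_abs_self _).trans hS
    _ = _ := by field_simp
end
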